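/- arXiv:2103.04840 — 3 statements merged into one kernel-verified Lean document; each statement's English description precedes it below -/
import Mathlib

section
/- For every prime ideal P of ℬ, the base change V_A^ℬ ⊗_ℬ k(P), where k(P) denotes the fraction field of ℬ/P, is a nonzero simple module over the group algebra k(P)[H]. (In the paper's terminology: the metaplectic representation V_A^ℬ is everywhere irreducible.) -/
set_option maxHeartbeats 1000000
set_option synthInstance.maxHeartbeats 1000000

noncomputable section

open scoped TensorProduct

/-! ## The base ring `𝒜`: the integral closure of `ℤ[1/p]` in a cyclotomic field -/

instance cycloAlgebra (p : ℕ) [NeZero p] (m : ℕ+) :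
    Algebra (Localization.Away (p : ℤ)) (CyclotomicField m ℚ) :=
  (Localization.awayLift (algebraMap ℤ (CyclotomicField m ℚ)) _
    (by
      rw [map_natCast]
      have h1 : IsUnit ((p : ℕ) : ℚ) :=
        isUnit_iff_ne_zero.mpr (Nat.cast_ne_zero.mpr (NeZero.ne p))
      have h2 := h1.map (algebraMap ℚ (CyclotomicField m ℚ))
      rwa [map_natCast] at h2)).toAlgebra

/-- The integral closure of `ℤ[1/p]` in the `m`-th cyclotomic field `ℚ(ζ_m)`. -/
def Aint (p : ℕ) [NeZero p] (m : ℕ+) :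
    Subalgebra (Localization.Away (p : ℤ)) (CyclotomicField m ℚ) :=
  integralClosure (Localization.Away (p : ℤ)) (CyclotomicField m ℚ)

/-- The ring `𝒜` associated to a finite field of characteristic `p` : the integral
closure of `ℤ[1/p]` in `ℚ(ζ_p)`. -/
def AA (p : ℕ+) : Type := ↥(Aint (p : ℕ) p)

instance (p : ℕ+) : CommRing (AA p) := inferInstanceAs (CommRing ↥(Aint (p : ℕ) p))

attribute [irreducible] AA

/-! ## The Heisenberg group -/

variable {F : Type*} [Field F] {W : Type*} [AddCommGroup W] [Module F W]

/-- The Heisenberg group attached to the bilinear form `β` : the set `W × F` with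
multiplication `(w,t)(w',t') = (w+w', t+t'+½⟨w,w'⟩)`. -/
@[ext]
structure Heis (β : W →ₗ[F] W →ₗ[F] F) : Type _ where
  w : W
  t : F

namespace Heis

variable {β : W →ₗ[F] W →ₗ[F] F}

instance : Mul (Heis β) :=
  ⟨fun a b => ⟨a.w + b.w, a.t + b.t + (2 : F)⁻¹ * β a.w b.w⟩⟩

instance : One (Heis β) := ⟨⟨0, 0⟩⟩

instance : Inv (Heis β) :=
  ⟨fun a => ⟨-a.w, -a.t + (2 : F)⁻¹ * β a.w a.w⟩⟩

@[simp] lemma mul_w (a b : Heis β) : (a * b).w = a.w + b.w := rfl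
@[simp] lemma mul_t (a b : Heis β) :
    (a * b).t = a.t + b.t + (2 : F)⁻¹ * β a.w b.w := rfl
@[simp] lemma one_w : (1 : Heis β).w = 0 := rfl
@[simp] lemma one_t : (1 : Heis β).t = 0 := rfl
@[simp] lemma inv_w (a : Heis β) : a⁻¹.w = -a.w := rfl
@[simp] lemma inv_t (a : Heis β) :
    a⁻¹.t = -a.t + (2 : F)⁻¹ * β a.w a.w := rfl

instance : Group (Heis β) where
  mul_assoc a b c := by
    ext
    · simp [add_assoc]
    · simp [map_add, LinearMap.add_apply]
      ring
  one_mul a := by ext <;> simp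
  mul_one a := by ext <;> simp
  inv_mul_cancel a := by
    ext
    · simp
    · simp [map_neg, LinearMap.neg_apply]

end Heis

/-! ## The induced representation `V_A^ℬ = ind_{A_H}^H(ψ_A^ℬ)` -/

/-- The compactly induced representation `ind_{A_H}^H ψ_A^ℬ`, realised as the
`ℬ`-submodule of functions `f : H → ℬ` with `f(ah) = ψ_A^ℬ(a) f(h)` for `a ∈ A_H`. -/
def IndV (β : W →ₗ[F] W →ₗ[F] F) (ℬ : Type*) [CommRing ℬ] (A : AddSubgroup W)
    (χ : Heis β → ℬˣ) : Submodule ℬ (Heis β → ℬ) where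
  carrier := {f | ∀ a : Heis β, a.w ∈ A → ∀ h : Heis β, f (a * h) = (χ a : ℬ) * f h}
  add_mem' := by
    intro f g hf hg a ha h
    simp only [Pi.add_apply, hf a ha h, hg a ha h, mul_add]
  zero_mem' := by intro a ha h; simp
  smul_mem' := by
    intro c f hf a ha h
    simp only [Pi.smul_apply, smul_eq_mul, hf a ha h]
    ring

/-- Right translation action of `h₀ ∈ H` on functions `H → ℬ`. -/
def hAct (β : W →ₗ[F] W →ₗ[F] F) (ℬ : Type*) [CommRing ℬ] (h₀ : Heis β) :
    (Heis β → ℬ) →ₗ[ℬ] (Heis β → ℬ) where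
  toFun f := fun h => f (h * h₀)
  map_add' _ _ := rfl
  map_smul' _ _ := rfl

lemma hAct_mem (β : W →ₗ[F] W →ₗ[F] F) (ℬ : Type*) [CommRing ℬ] (A : AddSubgroup W)
    (χ : Heis β → ℬˣ) (h₀ : Heis β) (f : Heis β → ℬ) (hf : f ∈ IndV β ℬ A χ) :
    hAct β ℬ h₀ f ∈ IndV β ℬ A χ := by
  intro a ha h
  simpa [hAct, mul_assoc] using hf a ha (h * h₀)

/-- The action `ρ` of the Heisenberg group on `V_A^ℬ`. -/
def hActV (β : W →ₗ[F] W →ₗ[F] F) (ℬ : Type*) [CommRing ℬ] (A : AddSubgroup W)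
    (χ : Heis β → ℬˣ) (h₀ : Heis β) :
    ↥(IndV β ℬ A χ) →ₗ[ℬ] ↥(IndV β ℬ A χ) :=
  (hAct β ℬ h₀).restrict fun f hf => hAct_mem β ℬ A χ h₀ f hf

/-! ## The symplectic group and its action on the Heisenberg group -/

/-- Action of a linear automorphism `g` on the Heisenberg group: `g·(w,t) = (gw,t)`. -/
def gHeis (β : W →ₗ[F] W →ₗ[F] F) (g : W ≃ₗ[F] W) : Heis β → Heis β :=
  fun h => ⟨g h.w, h.t⟩

/-- The symplectic group `Sp(W)` of the form `β`, as a subgroup of the linear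
automorphism group of `W`. -/
def SpGrp (β : W →ₗ[F] W →ₗ[F] F) : Subgroup (W ≃ₗ[F] W) where
  carrier := {g | ∀ u v : W, β (g u) (g v) = β u v}
  one_mem' := fun _ _ => rfl
  mul_mem' := by
    intro g g' hg hg' u v
    have h : ∀ x, (g * g') x = g (g' x) := fun _ => rfl
    rw [h, h, hg, hg']
  inv_mem' := by
    intro g hg u v
    have h1 := hg (g⁻¹ u) (g⁻¹ v)
    have h2 : ∀ x, g (g⁻¹ x) = x := fun x => g.apply_symm_apply x
    rw [h2, h2] at h1
    exact h1.symm

/-- The defining condition of the metaplectic group over `ℬ` : pairs `(g, M)` with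
`g ∈ Sp(W)` and `M ∘ ρ(h) = ρ(g·h) ∘ M` for all `h ∈ H`. -/
def MetaCond (β : W →ₗ[F] W →ₗ[F] F) (ℬ : Type*) [CommRing ℬ] (A : AddSubgroup W)
    (χ : Heis β → ℬˣ)
    (x : (W ≃ₗ[F] W) × (↥(IndV β ℬ A χ) ≃ₗ[ℬ] ↥(IndV β ℬ A χ))) : Prop :=
  (∀ u v : W, β (x.1 u) (x.1 v) = β u v) ∧
    ∀ (h₀ : Heis β) (f : ↥(IndV β ℬ A χ)),
      x.2 (hActV β ℬ A χ h₀ f) = hActV β ℬ A χ (gHeis β x.1 h₀) (x.2 f)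

/-- The character `ψ_A^ℬ = φ ∘ ψ_A` of `A_H` with values in `ℬˣ`, obtained from a
character with values in `𝒜ˣ` via the structure morphism `φ : 𝒜 → ℬ`. -/
def chB (p : ℕ+) (ℬ : Type*) [CommRing ℬ] [Algebra (AA p) ℬ]
    {β : W →ₗ[F] W →ₗ[F] F} (ψA : Heis β → (AA p)ˣ) : Heis β → ℬˣ :=
  fun h => Units.map (algebraMap (AA p) ℬ).toMonoidHom (ψA h)

/-- The character `ψ^ℬ = φ ∘ ψ` of `F` with values in `ℬˣ`. -/
def psB (p : ℕ+) (ℬ : Type*) [CommRing ℬ] [Algebra (AA p) ℬ]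
    (ψ : F → (AA p)ˣ) : F → ℬˣ :=
  fun t => Units.map (algebraMap (AA p) ℬ).toMonoidHom (ψ t)

set_option synthInstance.maxHeartbeats 1000000

/-- The base-changed action of the Heisenberg group on `V_A^ℬ ⊗_ℬ k(P)`, where
`k(P)` is the fraction field of `ℬ/P`. -/
def heisRepResidue {F : Type*} [Field F] {W : Type*} [AddCommGroup W] [Module F W]
    (β : W →ₗ[F] W →ₗ[F] F) (ℬ : Type*) [CommRing ℬ] (A : AddSubgroup W)
    (χ : Heis β → ℬˣ) (P : Ideal ℬ) [P.IsPrime] :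
    Representation (FractionRing (ℬ ⧸ P)) (Heis β)
      (FractionRing (ℬ ⧸ P) ⊗[ℬ] ↥(IndV β ℬ A χ)) where
  toFun h₀ := LinearMap.baseChange (FractionRing (ℬ ⧸ P)) (hActV β ℬ A χ h₀)
  map_one' := by
    have h1 : hActV β ℬ A χ (1 : Heis β) = LinearMap.id := by
      refine LinearMap.ext fun f => Subtype.ext (funext fun h => ?_)
      show (f : Heis β → ℬ) (h * 1) = (f : Heis β → ℬ) h
      rw [mul_one]
    show LinearMap.baseChange (FractionRing (ℬ ⧸ P)) (hActV β ℬ A χ 1) = 1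
    rw [h1, LinearMap.baseChange_id]
    rfl
  map_mul' a b := by
    have h1 : hActV β ℬ A χ (a * b) = hActV β ℬ A χ a ∘ₗ hActV β ℬ A χ b := by
      refine LinearMap.ext fun f => Subtype.ext (funext fun h => ?_)
      show (f : Heis β → ℬ) (h * (a * b)) = (f : Heis β → ℬ) (h * a * b)
      rw [mul_assoc]
    show LinearMap.baseChange (FractionRing (ℬ ⧸ P)) (hActV β ℬ A χ (a * b)) =
      LinearMap.baseChange (FractionRing (ℬ ⧸ P)) (hActV β ℬ A χ a) *
        LinearMap.baseChange (FractionRing (ℬ ⧸ P)) (hActV β ℬ A χ b)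
    rw [h1, LinearMap.baseChange_comp]
    rfl

instance heisRepResidue.instAddCommGroup {F : Type*} [Field F] {W : Type*}
    [AddCommGroup W] [Module F W] (β : W →ₗ[F] W →ₗ[F] F) (ℬ : Type*) [CommRing ℬ]
    (A : AddSubgroup W) (χ : Heis β → ℬˣ) (P : Ideal ℬ) [P.IsPrime] :
    AddCommGroup ((heisRepResidue β ℬ A χ P).asModule) :=
  inferInstanceAs (AddCommGroup (FractionRing (ℬ ⧸ P) ⊗[ℬ] ↥(IndV β ℬ A χ)))

instance AA.instIsDomain (p : ℕ+) : IsDomain (AA p) := by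
  with_unfolding_all exact inferInstanceAs (IsDomain ↥(Aint (p : ℕ) p))

lemma isUnit_natCast_Aint (p : ℕ+) : IsUnit (((p : ℕ) : ↥(Aint (p : ℕ) p))) := by
  have h := (IsLocalization.Away.algebraMap_isUnit
    (S := Localization.Away (((p : ℕ) : ℤ))) (((p : ℕ) : ℤ))).map
    (algebraMap (Localization.Away (((p : ℕ) : ℤ))) ↥(Aint (p : ℕ) p))
  simpa using h

lemma isUnit_natCast_AA (p : ℕ+) : IsUnit (((p : ℕ) : AA p)) := by
  with_unfolding_all exact isUnit_natCast_Aint p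

/-- The cardinality of a subgroup of a finite-dimensional space over a finite field of
characteristic `p` is a unit in any ring in which `p` is a unit. -/
lemma isUnit_natCast_card_addSubgroup {p : ℕ} [hp : Fact p.Prime]
    {F : Type*} [Field F] [Finite F] [CharP F p]
    {W : Type*} [AddCommGroup W] [Module F W] [FiniteDimensional F W]
    (A : AddSubgroup W) {R : Type*} [CommRing R] (hR : IsUnit (p : R)) :
    IsUnit ((Nat.card A : ℕ) : R) := by
  have := Fintype.ofFinite F
  obtain ⟨n, -, hn⟩ := FiniteField.card F p
  have hdvd : Nat.card A ∣ p ^ (n * Module.finrank F W : ℕ) := by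
    rw [pow_mul, ← hn, ← Nat.card_eq_fintype_card, ← Module.natCard_eq_pow_finrank (K := F)]
    exact A.card_addSubgroup_dvd_card
  obtain ⟨m, -, hm⟩ := (Nat.dvd_prime_pow hp.out).mp hdvd
  rw [hm, Nat.cast_pow]
  exact hR.pow m

/-- A representation with a vector `δ` and a functional `ev` is simple as soon as `ev δ = 1`,
a nonzero multiple of `v ↦ ev v • δ` lies in the group algebra, and every vector is, up to a
nonzero scalar, a combination of translates of `δ` with the coefficients of `v` under `ev`. -/
lemma Representation.isSimpleModule_asModule_of_cyclic {k G M ι κ : Type*} [Field k] [Group G]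
    [AddCommGroup M] [Module k M] (ρ : Representation k G M) [Fintype ι] [Fintype κ]
    (ev : M →ₗ[k] k) (δ : M) (hδ : ev δ = 1)
    (c : ι → k) (x : ι → G) (n : k) (hn : n ≠ 0)
    (hproj : ∀ v, ∑ i, c i • ρ (x i) v = (n * ev v) • δ)
    (y : κ → G) (m : k) (hm : m ≠ 0)
    (hgen : ∀ v, ∑ j, ev (ρ (y j) v) • ρ (y j)⁻¹ δ = m • v) :
    IsSimpleModule (MonoidAlgebra k G) ρ.asModule := by
  have hδ0 : δ ≠ 0 := by
    rintro rfl
    simp at hδ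
  have : Nontrivial ρ.asModule := ⟨⟨ρ.asModuleEquiv.symm δ, 0, by simpa using hδ0⟩⟩
  have hsmul (N : Submodule (MonoidAlgebra k G) ρ.asModule) (r : k) {v : M}
      (hv : ρ.asModuleEquiv.symm v ∈ N) : ρ.asModuleEquiv.symm (r • v) ∈ N := by
    rw [Representation.asModuleEquiv_symm_map_smul]
    exact N.smul_mem _ hv
  have hact (N : Submodule (MonoidAlgebra k G) ρ.asModule) (g : G) {v : M}
      (hv : ρ.asModuleEquiv.symm v ∈ N) : ρ.asModuleEquiv.symm (ρ g v) ∈ N := by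
    rw [Representation.asModuleEquiv_symm_map_rho]
    exact N.smul_mem _ hv
  refine { eq_bot_or_eq_top := fun N => or_iff_not_imp_left.mpr fun hN => ?_ }
  obtain ⟨v', hv', hv0'⟩ := N.exists_mem_ne_zero_of_ne_bot hN
  obtain ⟨v, rfl⟩ := ρ.asModuleEquiv.symm.surjective v'
  have hv0 : v ≠ 0 := by simpa using hv0'
  obtain ⟨j, hj⟩ : ∃ j, ev (ρ (y j) v) ≠ 0 := by
    by_contra! h
    have := hgen v
    simp only [h, zero_smul, Finset.sum_const_zero] at this
    exact (smul_ne_zero hm hv0) this.symm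
  have hδN : ρ.asModuleEquiv.symm δ ∈ N := by
    have h1 : ρ.asModuleEquiv.symm ((n * ev (ρ (y j) v)) • δ) ∈ N := by
      rw [← hproj, map_sum]
      exact N.sum_mem fun i _ => hsmul N _ (hact N _ (hact N _ hv'))
    have h2 := hsmul N (n * ev (ρ (y j) v))⁻¹ h1
    rwa [smul_smul, inv_mul_cancel₀ (mul_ne_zero hn hj), one_smul] at h2
  refine (Submodule.eq_top_iff').mpr fun u' => ?_
  obtain ⟨u, rfl⟩ := ρ.asModuleEquiv.symm.surjective u'
  have h1 : ρ.asModuleEquiv.symm (m • u) ∈ N := by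
    rw [← hgen, map_sum]
    exact N.sum_mem fun i _ => hsmul N _ (hact N _ hδN)
  simpa [smul_smul, hm] using hsmul N m⁻¹ h1

section InducedModel

variable {R : Type*} [CommRing R] {β : W →ₗ[F] W →ₗ[F] F} {A : AddSubgroup W}
  {χ : Heis β → Rˣ}

open Classical in
/-- The function on the Heisenberg group that equals `χ` on `A_H` and vanishes elsewhere. -/
def IndV.delta (hχ : ∀ a b : Heis β, a.w ∈ A → b.w ∈ A → χ (a * b) = χ a * χ b) :
    IndV β R A χ :=
  ⟨fun g => if g.w ∈ A then (χ g : R) else 0, fun a ha h => by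
    by_cases hh : h.w ∈ A
    · simp [hh, A.add_mem ha hh, hχ a h ha hh]
    · simp [hh, A.add_mem_cancel_left ha]⟩

open Classical in
lemma IndV.delta_apply (hχ : ∀ a b : Heis β, a.w ∈ A → b.w ∈ A → χ (a * b) = χ a * χ b)
    (g : Heis β) :
    (IndV.delta hχ : Heis β → R) g = if g.w ∈ A then (χ g : R) else 0 := rfl

@[simp] lemma hActV_apply (h₀ : Heis β) (f : IndV β R A χ) (h : Heis β) :
    (hActV β R A χ h₀ f : Heis β → R) h = (f : Heis β → R) (h * h₀) := rfl

/-- Evaluation at the identity, as a functional on the induced representation. -/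
def IndV.evalOne : IndV β R A χ →ₗ[R] R := LinearMap.proj 1 ∘ₗ (IndV β R A χ).subtype

@[simp] lemma IndV.evalOne_apply (f : IndV β R A χ) :
    IndV.evalOne f = (f : Heis β → R) 1 := rfl

lemma IndV.apply_eq (f : IndV β R A χ) (g : Heis β) (hg : g.w ∈ A) :
    (f : Heis β → R) g = χ g * (f : Heis β → R) 1 := by
  simpa using f.2 g hg 1

lemma IndV.sum_evalOne_smul_delta [Fintype W]
    (hχ : ∀ a b : Heis β, a.w ∈ A → b.w ∈ A → χ (a * b) = χ a * χ b) (f : IndV β R A χ) :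
    ∑ w : W, IndV.evalOne (hActV β R A χ ⟨w, 0⟩ f) •
      hActV β R A χ (⟨w, 0⟩ : Heis β)⁻¹ (IndV.delta hχ) = (Nat.card A : R) • f := by
  classical
  refine Subtype.ext (funext fun g => ?_)
  have hterm (w : W) : (f : Heis β → R) ⟨w, 0⟩ *
      (IndV.delta hχ : Heis β → R) (g * (⟨w, 0⟩ : Heis β)⁻¹) =
      if g.w - w ∈ A then (f : Heis β → R) g else 0 := by
    rw [IndV.delta_apply]
    simp only [Heis.mul_w, Heis.inv_w, ← sub_eq_add_neg, mul_ite, mul_zero]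
    split_ifs with h
    · rw [mul_comm, ← f.2 _ (by simpa [← sub_eq_add_neg] using h), inv_mul_cancel_right]
    · rfl
  have hcard : ∑ w : W, (if g.w - w ∈ A then (f : Heis β → R) g else 0) =
      (Nat.card A : R) * (f : Heis β → R) g := by
    rw [Fintype.sum_equiv (Equiv.subLeft g.w)
      (fun w => if g.w - w ∈ A then (f : Heis β → R) g else 0)
      (fun w => if w ∈ A then (f : Heis β → R) g else 0) (fun _ => rfl),
      ← Finset.sum_filter, Finset.sum_const, nsmul_eq_mul, Nat.card_eq_fintype_card,
      Fintype.card_subtype]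
  simpa [Finset.sum_apply, hterm] using hcard

lemma Heis.mul_eq_mul_of_alternating (h2 : (2 : F) ≠ 0) (halt : ∀ v : W, β v v = 0)
    (h : Heis β) (a : W) :
    h * ⟨a, 0⟩ = ⟨a, 0⟩ * (⟨0, β h.w a⟩ : Heis β) * h := by
  have hanti : β a h.w = -β h.w a := (LinearMap.IsAlt.neg halt h.w a).symm
  ext
  · simp [add_comm]
  · simp [hanti]
    field_simp
    ring

lemma IndV.sum_inv_smul_hActV [Fintype A] (h2 : (2 : F) ≠ 0) (halt : ∀ v : W, β v v = 0)
    (hχ : ∀ a b : Heis β, a.w ∈ A → b.w ∈ A → χ (a * b) = χ a * χ b)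
    (hiso : ∀ v ∈ A, ∀ a ∈ A, χ ⟨0, β v a⟩ = 1)
    (hsum : ∀ v ∉ A, ∑ a : A, (χ ⟨0, β v a⟩ : R) = 0) (f : IndV β R A χ) :
    ∑ a : A, ((χ ⟨a, 0⟩)⁻¹ : Rˣ).val • hActV β R A χ ⟨a, 0⟩ f =
      ((Nat.card A : R) * IndV.evalOne f) • IndV.delta hχ := by
  classical
  refine Subtype.ext (funext fun g => ?_)
  have hterm (a : A) : ((χ ⟨a, 0⟩)⁻¹ : Rˣ).val * (f : Heis β → R) (g * ⟨a, 0⟩) =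
      (χ ⟨0, β g.w a⟩ : R) * (f : Heis β → R) g := by
    rw [Heis.mul_eq_mul_of_alternating h2 halt, f.2 _ (by simp), hχ _ _ a.2 A.zero_mem]
    simp [mul_assoc]
  have key : ∑ a : A, ((χ ⟨0, β g.w a⟩ : R) * (f : Heis β → R) g) =
      (Nat.card A : R) * (f : Heis β → R) 1 * (IndV.delta hχ : Heis β → R) g := by
    rw [← Finset.sum_mul, IndV.delta_apply]
    split_ifs with hg
    · rw [IndV.apply_eq f g hg]
      simp [hiso g.w hg, mul_comm, mul_left_comm]
    · simp [hsum g.w hg]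
  simpa [Finset.sum_apply, hterm] using key

end InducedModel

/-- A nontrivial multiplicative function on a finite group with values in a domain sums to
zero. -/
lemma sum_eq_zero_of_map_add {G D : Type*} [AddGroup G] [Fintype G] [CommRing D] [IsDomain D]
    (θ : G → D) (hθ : ∀ a b, θ (a + b) = θ a * θ b) {a₀ : G} (ha₀ : θ a₀ ≠ 1) :
    ∑ a, θ a = 0 := by
  have h : θ a₀ * ∑ a, θ a = ∑ a, θ a := by
    rw [Finset.mul_sum, ← Fintype.sum_equiv (Equiv.addLeft a₀) (fun a => θ a₀ * θ a) θ
      (fun a => (hθ a₀ a).symm)]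
  have : (θ a₀ - 1) * ∑ a, θ a = 0 := by rw [sub_mul, h, one_mul, sub_self]
  exact (mul_eq_zero.mp this).resolve_left (sub_ne_zero.mpr ha₀)

/-- For every prime ideal `P` of `ℬ`, the base change
`V_A^ℬ ⊗_ℬ k(P)` is a nonzero simple module over the group algebra `k(P)[H]`:
the metaplectic representation `V_A^ℬ` is everywhere irreducible. -/
theorem statement_0
    (p : ℕ+) [Fact (Nat.Prime (p : ℕ))] (hp2 : (p : ℕ) ≠ 2)
    {F : Type*} [Field F] [Fintype F] [CharP F (p : ℕ)]
    {W : Type*} [AddCommGroup W] [Module F W] [FiniteDimensional F W]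
    (β : W →ₗ[F] W →ₗ[F] F)
    (halt : ∀ v : W, β v v = 0)
    (hnd : ∀ v : W, (∀ u : W, β v u = 0) → v = 0)
    (ℬ : Type*) [CommRing ℬ] [Algebra (AA p) ℬ]
    (ψ : F → (AA p)ˣ) (hψ : ∀ x y : F, ψ (x + y) = ψ x * ψ y)
    (hψnt : ∃ x : F, ψ x ≠ 1)
    (A : AddSubgroup W)
    (hA : ∀ v : W, (∀ a ∈ A, ψ (β v a) = 1) ↔ v ∈ A)
    (ψA : Heis β → (AA p)ˣ)
    (hψA : ∀ a b : Heis β, a.w ∈ A → b.w ∈ A → ψA (a * b) = ψA a * ψA b)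
    (hψAext : ∀ t : F, ψA ⟨0, t⟩ = ψ t)
    (P : Ideal ℬ) [P.IsPrime] :
    Nontrivial ((heisRepResidue β ℬ A (chB p ℬ ψA) P).asModule) ∧
    IsSimpleModule (MonoidAlgebra (FractionRing (ℬ ⧸ P)) (Heis β))
      ((heisRepResidue β ℬ A (chB p ℬ ψA) P).asModule) := by
  have h2 : (2 : F) ≠ 0 := Ring.two_ne_zero (by rwa [ringChar.eq F (p : ℕ)])
  have : Finite W := Module.finite_of_finite F
  have := Fintype.ofFinite W
  have := Fintype.ofFinite A
  set χ : Heis β → ℬˣ := chB p ℬ ψA with hχdef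
  set k := FractionRing (ℬ ⧸ P)
  have hχ : ∀ a b : Heis β, a.w ∈ A → b.w ∈ A → χ (a * b) = χ a * χ b := fun a b ha hb => by
    simp only [hχdef, chB, hψA a b ha hb, map_mul]
  have hiso : ∀ v ∈ A, ∀ a ∈ A, χ ⟨0, β v a⟩ = 1 := fun v hv a ha => by
    simp only [hχdef, chB, hψAext, (hA v).mpr hv a ha, map_one]
  have hsum : ∀ v ∉ A, ∑ a : A, (χ ⟨0, β v a⟩ : ℬ) = 0 := fun v hv => by
    rw [← hA v] at hv
    push Not at hv
    obtain ⟨a₀, ha₀, hne⟩ := hv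
    have h0 := sum_eq_zero_of_map_add (fun a : A => (ψ (β v a) : AA p))
      (fun a b => by simp [hψ]) (a₀ := ⟨a₀, ha₀⟩) (by simpa using hne)
    simpa [hχdef, chB, hψAext] using congrArg (algebraMap (AA p) ℬ) h0
  have hcard : (Nat.card A : k) ≠ 0 := by
    have h := ((isUnit_natCast_card_addSubgroup (F := F) A (isUnit_natCast_AA p)).map
      (algebraMap (AA p) ℬ)).map (algebraMap ℬ k)
    simpa using h.ne_zero
  let ev : k ⊗[ℬ] ↥(IndV β ℬ A χ) →ₗ[k] k :=
    TensorProduct.AlgebraTensorModule.lift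
      ((LinearMap.toSpanSingleton k _ ((Algebra.linearMap ℬ k) ∘ₗ IndV.evalOne)))
  have hev (c : k) (f : IndV β ℬ A χ) :
      ev (c ⊗ₜ f) = c * algebraMap ℬ k (IndV.evalOne f) := rfl
  have hρ (h₀ : Heis β) (c : k) (f : IndV β ℬ A χ) :
      heisRepResidue β ℬ A χ P h₀ (c ⊗ₜ f) = c ⊗ₜ hActV β ℬ A χ h₀ f := rfl
  let δ : k ⊗[ℬ] ↥(IndV β ℬ A χ) := 1 ⊗ₜ IndV.delta hχ
  have hδ : ev δ = 1 := by
    have h1 : χ 1 = 1 := by simpa using hχ 1 1 A.zero_mem A.zero_mem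
    simp [δ, hev, IndV.delta_apply, h1]
  have hsimple : IsSimpleModule (MonoidAlgebra k (Heis β))
      ((heisRepResidue β ℬ A χ P).asModule) := by
    refine Representation.isSimpleModule_asModule_of_cyclic (heisRepResidue β ℬ A χ P) ev δ hδ
      (fun a : A => algebraMap ℬ k ((χ ⟨a, 0⟩)⁻¹ : ℬˣ).val) (fun a => ⟨a, 0⟩)
      (Nat.card A : k) hcard (fun v => ?_) (fun w : W => ⟨w, 0⟩) (Nat.card A : k) hcard
      (fun v => ?_)
    · induction v with
      | zero => simp
      | add u v hu hv => simp only [map_add, smul_add, Finset.sum_add_distrib, hu, hv, mul_add,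
          add_smul]
      | tmul c f =>
        have h := congrArg (fun f' => c ⊗ₜ[ℬ] f')
          (IndV.sum_inv_smul_hActV h2 halt hχ hiso hsum f)
        simp only [TensorProduct.tmul_sum, TensorProduct.tmul_smul, TensorProduct.smul_tmul',
          Algebra.smul_def, map_mul, map_natCast] at h
        simp only [hρ, hev, δ, TensorProduct.smul_tmul', smul_eq_mul, mul_one]
        refine h.trans ?_
        congr 1
        ring
    · induction v with
      | zero => simp
      | add u v hu hv => simp only [map_add, add_smul, Finset.sum_add_distrib, hu, hv, smul_add]
      | tmul c f =>
        have h := congrArg (fun f' => c ⊗ₜ[ℬ] f') (IndV.sum_evalOne_smul_delta hχ f)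
        simp only [TensorProduct.tmul_sum, TensorProduct.tmul_smul] at h
        have hc : (Nat.card A : k) • (c ⊗ₜ[ℬ] f) = (Nat.card A : ℬ) • (c ⊗ₜ[ℬ] f) := by
          rw [← algebraMap_smul k (Nat.card A : ℬ), map_natCast]
        rw [hc, ← h]
        refine Finset.sum_congr rfl fun w _ => ?_
        simp only [hρ, hev, δ, TensorProduct.smul_tmul', smul_eq_mul, mul_one]
        congr 1
        rw [Algebra.smul_def, mul_comm]
  exact ⟨⟨⟨δ, 0, fun h => zero_ne_one (by rw [← hδ, show δ = 0 from h, map_zero])⟩⟩, hsimple⟩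
end
end

section
/- V_A^ℬ satisfies Schur's lemma over the ring ℬ: every ℬ[H]-module endomorphism of V_A^ℬ is multiplication by a scalar of ℬ, i.e. End_{ℬ[H]}(V_A^ℬ) = ℬ·id. -/
set_option maxHeartbeats 1000000
set_option synthInstance.maxHeartbeats 1000000

noncomputable section

open scoped TensorProduct

/-! ## The Heisenberg group -/

variable {F : Type*} [Field F] {W : Type*} [AddCommGroup W] [Module F W]

/-! ## Arithmetic of `𝒜` -/

lemma AA.isDomain (p : ℕ+) : IsDomain (AA p) := by
  with_unfolding_all exact inferInstanceAs (IsDomain ↥(Aint (p : ℕ) p))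

lemma AA.isUnit_natCast (p : ℕ+) : IsUnit ((p : ℕ) : AA p) := by
  have h : IsUnit (((p : ℕ) : ℤ) : Localization.Away ((p : ℕ) : ℤ)) := by
    simpa using IsLocalization.Away.algebraMap_isUnit
      (S := Localization.Away ((p : ℕ) : ℤ)) ((p : ℕ) : ℤ)
  have hmap := h.map (algebraMap (Localization.Away ((p : ℕ) : ℤ)) ↥(Aint (p : ℕ) p))
  rw [map_intCast, Int.cast_natCast] at hmap
  with_unfolding_all exact hmap

/-- The order of a subgroup of a finite-dimensional space over a finite field of characteristic
`p` is invertible in `𝒜`. -/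
lemma AA.isUnit_card_addSubgroup (p : ℕ+) [Fact (Nat.Prime (p : ℕ))]
    {F : Type*} [Field F] [Fintype F] [CharP F (p : ℕ)]
    {W : Type*} [AddCommGroup W] [Module F W] [FiniteDimensional F W] (A : AddSubgroup W) :
    IsUnit ((Nat.card A : ℕ) : AA p) := by
  obtain ⟨n, -, hn⟩ := FiniteField.card F (p : ℕ)
  have hW : Nat.card W = ((p : ℕ) ^ (n : ℕ)) ^ Module.finrank F W := by
    rw [Module.natCard_eq_pow_finrank (K := F), Nat.card_eq_fintype_card, hn]
  have hdvd : ((Nat.card A : ℕ) : AA p) ∣ ((Nat.card W : ℕ) : AA p) :=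
    Nat.cast_dvd_cast A.card_addSubgroup_dvd_card
  refine isUnit_of_dvd_unit hdvd ?_
  rw [hW]
  push_cast
  exact ((AA.isUnit_natCast p).pow _).pow _

/-- A nontrivial character of a finite group with values in a domain sums to zero. -/
lemma sum_character_eq_zero {G R : Type*} [AddGroup G] [Fintype G] [CommRing R] [IsDomain R]
    (θ : G → R) (hθ : ∀ x y, θ (x + y) = θ x * θ y) {a : G} (ha : θ a ≠ 1) :
    ∑ x, θ x = 0 := by
  have h : θ a * ∑ x, θ x = ∑ x, θ x := by
    rw [Finset.mul_sum, ← Equiv.sum_comp (Equiv.addLeft a) θ]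
    simp [hθ]
  have hmul : (θ a - 1) * ∑ x, θ x = 0 := by rw [sub_mul, h, one_mul, sub_self]
  exact (mul_eq_zero.mp hmul).resolve_left (sub_ne_zero.mpr ha)

namespace Heis

variable {β : W →ₗ[F] W →ₗ[F] F}

/-- The commutation rule `h a = (0, ⟨h, a⟩) a h` of the Heisenberg group. -/
lemma mul_eq_central_mul (halt : ∀ v : W, β v v = 0) (h2 : (2 : F) ≠ 0) (h a : Heis β) :
    h * a = ⟨0, β h.w a.w⟩ * a * h := by
  have hskew : β a.w h.w = -β h.w a.w := by
    have := halt (a.w + h.w)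
    simp only [map_add, LinearMap.add_apply, halt, zero_add, add_zero] at this
    exact eq_neg_of_add_eq_zero_right this
  ext
  · simp [add_comm]
  · simp [hskew]
    field_simp
    ring

end Heis

section InducedFunctions

variable {β : W →ₗ[F] W →ₗ[F] F} {ℬ : Type*} [CommRing ℬ] {A : AddSubgroup W} {χ : Heis β → ℬˣ}

open Classical in
/-- The function of `ind_{A_H}^H χ` supported on `A_H` and equal to `χ` there. -/
def baseFun (hχ : ∀ a b : Heis β, a.w ∈ A → b.w ∈ A → χ (a * b) = χ a * χ b) :
    ↥(IndV β ℬ A χ) :=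
  ⟨fun h => if h.w ∈ A then (χ h : ℬ) else 0, by
    intro a ha h
    have hmem : (a * h).w ∈ A ↔ h.w ∈ A := A.add_mem_cancel_left ha
    by_cases hh : h.w ∈ A
    · simp only [if_pos (hmem.mpr hh), if_pos hh, hχ a h ha hh, Units.val_mul]
    · simp only [if_neg (mt hmem.mp hh), if_neg hh, mul_zero]⟩

variable (hχ : ∀ a b : Heis β, a.w ∈ A → b.w ∈ A → χ (a * b) = χ a * χ b)

lemma baseFun_of_mem {h : Heis β} (hh : h.w ∈ A) : (baseFun hχ).1 h = χ h := if_pos hh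

lemma baseFun_of_notMem {h : Heis β} (hh : h.w ∉ A) : (baseFun hχ).1 h = 0 := if_neg hh

/-- The group `A_H` acts on `baseFun` through `χ`. -/
lemma hActV_baseFun {a : Heis β} (ha : a.w ∈ A) :
    hActV β ℬ A χ a (baseFun hχ) = (χ a : ℬ) • baseFun hχ := by
  ext h
  change (baseFun hχ).1 (h * a) = χ a * (baseFun hχ).1 h
  have hmem : (h * a).w ∈ A ↔ h.w ∈ A := A.add_mem_cancel_right ha
  by_cases hh : h.w ∈ A
  · rw [baseFun_of_mem hχ hh, baseFun_of_mem hχ (hmem.mpr hh), hχ h a hh ha, Units.val_mul,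
      mul_comm]
  · rw [baseFun_of_notMem hχ hh, baseFun_of_notMem hχ (mt hmem.mp hh), mul_zero]

/-- Up to the factor `|A|`, every function of `ind_{A_H}^H χ` is a combination of translates of
`baseFun`. -/
lemma card_smul_eq_sum_translates [Fintype W] (f : ↥(IndV β ℬ A χ)) :
    (Nat.card A : ℬ) • f =
      ∑ w : W, f.1 ⟨w, 0⟩ • hActV β ℬ A χ (⟨w, 0⟩ : Heis β)⁻¹ (baseFun hχ) := by
  classical
  ext h
  rw [AddSubmonoidClass.coe_finsetSum, Finset.sum_apply]
  change (Nat.card A : ℬ) * f.1 h =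
    ∑ w : W, f.1 ⟨w, 0⟩ * (baseFun hχ).1 (h * (⟨w, 0⟩ : Heis β)⁻¹)
  have hterm : ∀ w : W, f.1 ⟨w, 0⟩ * (baseFun hχ).1 (h * (⟨w, 0⟩ : Heis β)⁻¹) =
      if h.w - w ∈ A then f.1 h else 0 := by
    intro w
    have hw : (h * (⟨w, 0⟩ : Heis β)⁻¹).w = h.w - w := (sub_eq_add_neg _ _).symm
    split_ifs with hA
    · rw [← hw] at hA
      have := f.2 _ hA ⟨w, 0⟩
      rw [inv_mul_cancel_right] at this
      rw [baseFun_of_mem hχ hA, this, mul_comm]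
    · rw [← hw] at hA
      rw [baseFun_of_notMem hχ hA, mul_zero]
  have hshift : ∑ w : W, (if h.w - w ∈ A then f.1 h else 0) =
      ∑ v : W, if v ∈ A then f.1 h else 0 :=
    Equiv.sum_comp (Equiv.subLeft h.w) fun v => if v ∈ A then f.1 h else 0
  rw [Finset.sum_congr rfl fun w _ => hterm w, hshift, Finset.sum_ite, Finset.sum_const,
    Finset.sum_const_zero, add_zero, nsmul_eq_mul, Nat.card_eq_fintype_card, Fintype.card_subtype]

/-- An `H`-endomorphism of `ind_{A_H}^H χ` under which `baseFun` is an eigenvector is a scalar. -/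
lemma eq_smul_of_baseFun_eigenvector [Fintype W] (hcard : IsUnit (Nat.card A : ℬ))
    {T : ↥(IndV β ℬ A χ) →ₗ[ℬ] ↥(IndV β ℬ A χ)}
    (hT : ∀ (h₀ : Heis β) (f : ↥(IndV β ℬ A χ)),
      T (hActV β ℬ A χ h₀ f) = hActV β ℬ A χ h₀ (T f))
    {c : ℬ} (hc : T (baseFun hχ) = c • baseFun hχ) (f : ↥(IndV β ℬ A χ)) : T f = c • f := by
  refine hcard.smul_left_cancel.mp ?_
  rw [← map_smul, smul_comm, card_smul_eq_sum_translates hχ f, map_sum, Finset.smul_sum]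
  refine Finset.sum_congr rfl fun w _ => ?_
  rw [map_smul, hT, hc, map_smul, smul_comm]

/-- A function of `ind_{A_H}^H χ` on which `A_H` acts through `χ` is killed, at `h`, by
`χ (0, ⟨h, a⟩) - 1` for all `a ∈ A`. -/
lemma central_mul_apply_eq (halt : ∀ v : W, β v v = 0) (h2 : (2 : F) ≠ 0)
    (f : ↥(IndV β ℬ A χ)) {a : Heis β} (ha : a.w ∈ A)
    (hf : hActV β ℬ A χ a f = (χ a : ℬ) • f) (h : Heis β) :
    (χ ⟨0, β h.w a.w⟩ : ℬ) * f.1 h = f.1 h := by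
  have h1 : f.1 (h * a) = χ a * f.1 h := congrFun (congrArg Subtype.val hf) h
  rw [Heis.mul_eq_central_mul halt h2, mul_assoc, f.2 _ A.zero_mem, f.2 a ha,
    mul_left_comm] at h1
  exact (χ a).isUnit.mul_left_cancel h1

end InducedFunctions

/-- `V_A^ℬ` satisfies Schur's lemma over the ring `ℬ`: every
`ℬ[H]`-module endomorphism of `V_A^ℬ` is multiplication by a scalar of `ℬ`. -/
theorem statement_2
    (p : ℕ+) [Fact (Nat.Prime (p : ℕ))] (hp2 : (p : ℕ) ≠ 2)
    {F : Type*} [Field F] [Fintype F] [CharP F (p : ℕ)]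
    {W : Type*} [AddCommGroup W] [Module F W] [FiniteDimensional F W]
    (β : W →ₗ[F] W →ₗ[F] F)
    (halt : ∀ v : W, β v v = 0)
    (hnd : ∀ v : W, (∀ u : W, β v u = 0) → v = 0)
    (ℬ : Type*) [CommRing ℬ] [Algebra (AA p) ℬ]
    (ψ : F → (AA p)ˣ) (hψ : ∀ x y : F, ψ (x + y) = ψ x * ψ y)
    (hψnt : ∃ x : F, ψ x ≠ 1)
    (A : AddSubgroup W)
    (hA : ∀ v : W, (∀ a ∈ A, ψ (β v a) = 1) ↔ v ∈ A)
    (ψA : Heis β → (AA p)ˣ)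
    (hψA : ∀ a b : Heis β, a.w ∈ A → b.w ∈ A → ψA (a * b) = ψA a * ψA b)
    (hψAext : ∀ t : F, ψA ⟨0, t⟩ = ψ t) :
    ∀ T : ↥(IndV β ℬ A (chB p ℬ ψA)) →ₗ[ℬ] ↥(IndV β ℬ A (chB p ℬ ψA)),
      (∀ (h₀ : Heis β) (f : ↥(IndV β ℬ A (chB p ℬ ψA))),
          T (hActV β ℬ A (chB p ℬ ψA) h₀ f) = hActV β ℬ A (chB p ℬ ψA) h₀ (T f)) →
      ∃ c : ℬ, ∀ f : ↥(IndV β ℬ A (chB p ℬ ψA)), T f = c • f := by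
  intro T hT
  have := AA.isDomain p
  have : Finite W := Module.finite_of_finite F
  have := Fintype.ofFinite W
  have := Fintype.ofFinite A
  have h2 : (2 : F) ≠ 0 := Ring.two_ne_zero (by rwa [ringChar.eq F (p : ℕ)])
  have hcard : IsUnit (Nat.card A : ℬ) := by
    simpa using (AA.isUnit_card_addSubgroup (F := F) p A).map (algebraMap (AA p) ℬ)
  have hχ : ∀ a b : Heis β, a.w ∈ A → b.w ∈ A →
      chB p ℬ ψA (a * b) = chB p ℬ ψA a * chB p ℬ ψA b := fun a b ha hb => by
    simp only [chB, hψA a b ha hb, map_mul]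
  have heig : ∀ a : Heis β, a.w ∈ A → hActV β ℬ A (chB p ℬ ψA) a (T (baseFun hχ)) =
      (chB p ℬ ψA a : ℬ) • T (baseFun hχ) := fun a ha => by
    rw [← hT, hActV_baseFun hχ ha, map_smul]
  have hsupp : ∀ h : Heis β, h.w ∉ A → (T (baseFun hχ)).1 h = 0 := by
    intro h hh
    obtain ⟨a, ha, hne⟩ : ∃ a ∈ A, ψ (β h.w a) ≠ 1 := by
      by_contra! hall
      exact hh ((hA _).mp hall)
    have hsum : ∑ x : A, (ψ (β h.w x) : AA p) = 0 :=
      sum_character_eq_zero (fun x : A => (ψ (β h.w x) : AA p))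
        (fun x y => by simp [hψ]) (a := ⟨a, ha⟩) (by simpa using hne)
    have hfix : ∀ x : A, algebraMap (AA p) ℬ (ψ (β h.w x)) * (T (baseFun hχ)).1 h =
        (T (baseFun hχ)).1 h := fun x => by
      rw [← hψAext]
      exact central_mul_apply_eq halt h2 _ (a := ⟨x, 0⟩) x.2 (heig _ x.2) h
    have hzero : (Nat.card A : ℬ) * (T (baseFun hχ)).1 h = 0 := by
      calc (Nat.card A : ℬ) * (T (baseFun hχ)).1 h
          = ∑ x : A, algebraMap (AA p) ℬ (ψ (β h.w x)) * (T (baseFun hχ)).1 h := by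
            rw [Finset.sum_congr rfl fun x _ => hfix x, Finset.sum_const, nsmul_eq_mul,
              Finset.card_univ, Nat.card_eq_fintype_card]
        _ = 0 := by rw [← Finset.sum_mul, ← map_sum, hsum, map_zero, zero_mul]
    exact hcard.mul_right_eq_zero.mp hzero
  refine ⟨(T (baseFun hχ)).1 1, eq_smul_of_baseFun_eigenvector hχ hcard hT ?_⟩
  ext h
  change (T (baseFun hχ)).1 h = (T (baseFun hχ)).1 1 * (baseFun hχ).1 h
  by_cases hh : h.w ∈ A
  · rw [baseFun_of_mem hχ hh, mul_comm, ← (T (baseFun hχ)).2 h hh, mul_one]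
  · rw [baseFun_of_notMem hχ hh, hsupp h hh, mul_zero]
end
end

section
/- For every g ∈ Sp(W) there exists a ℬ-linear automorphism M of V_A^ℬ such that M ∘ ρ(h) = ρ(g·h) ∘ M for all h ∈ H, where ρ denotes the action of H on V_A^ℬ and g·(w,t) = (gw,t). -/
set_option maxHeartbeats 1000000
set_option synthInstance.maxHeartbeats 1000000

noncomputable section

open scoped TensorProduct

/-! ## The Heisenberg group -/

variable {F : Type*} [Field F] {W : Type*} [AddCommGroup W] [Module F W]

/-! ## The base ring: inverting `p` and extending characters -/

instance AA.isDomain_s5 (p : ℕ+) : IsDomain (AA p) := by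
  with_unfolding_all exact inferInstanceAs (IsDomain ↥(Aint (p : ℕ) p))

/-- If `p` is invertible in `R`, so is the order of every subgroup of a finite-dimensional vector
space over a finite field of characteristic `p`. -/
lemma isUnit_natCard_addSubgroup (p : ℕ) [Fact p.Prime] [Finite F] [CharP F p]
    [FiniteDimensional F W] {R : Type*} [CommRing R] (hp : IsUnit (p : R)) (A : AddSubgroup W) :
    IsUnit (Nat.card A : R) := by
  have := Fintype.ofFinite F
  obtain ⟨n, -, hn⟩ := FiniteField.card F p
  have hW : Nat.card W = (p ^ (n : ℕ)) ^ Module.finrank F W := by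
    rw [Module.natCard_eq_pow_finrank (K := F), Nat.card_eq_fintype_card, hn]
  refine isUnit_of_dvd_unit (Nat.cast_dvd_cast (α := R) A.card_addSubgroup_dvd_card) ?_
  rw [hW]
  push_cast
  exact (hp.pow _).pow _

section Characters

variable {R : Type*} [CommRing R] {β : W →ₗ[F] W →ₗ[F] F} {ψ : F → Rˣ}

lemma map_zero_eq_one (hψ : ∀ x y, ψ (x + y) = ψ x * ψ y) : ψ 0 = 1 := by
  simpa using hψ 0 0

lemma map_nsmul_eq_pow (hψ : ∀ x y, ψ (x + y) = ψ x * ψ y) (n : ℕ) (x : F) :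
    ψ (n • x) = ψ x ^ n := by
  induction n with
  | zero => simp [map_zero_eq_one hψ]
  | succ n ih => rw [succ_nsmul, hψ, ih, pow_succ]

variable [IsDomain R]

/-- Every character of an additive subgroup of `W` is of the form `a ↦ ψ ⟨w, a⟩`. -/
lemma exists_eq_psi_pairing (p : ℕ) [Fact p.Prime] [CharP F p] [Finite W]
    (hnd : ∀ v : W, (∀ u : W, β v u = 0) → v = 0)
    (hψ : ∀ x y, ψ (x + y) = ψ x * ψ y) (hψnt : ∃ x, ψ x ≠ 1)
    (A : AddSubgroup W) (γ : Multiplicative A →* Rˣ) :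
    ∃ w : W, ∀ a : A, γ (.ofAdd a) = ψ (β w a) := by
  have hexp : Monoid.exponent (Multiplicative W) ∣ p :=
    Monoid.exponent_dvd_of_forall_pow_eq_one fun w ↦ by
      apply Multiplicative.toAdd.injective
      change p • w.toAdd = 0
      rw [← Nat.cast_smul_eq_nsmul F, CharP.cast_eq_zero, zero_smul]
  have : NeZero p := ⟨(Fact.out : p.Prime).ne_zero⟩
  have : HasEnoughRootsOfUnity R p :=
    { prim := by
        obtain ⟨x, hx⟩ := hψnt
        have hpow : ψ x ^ p = 1 := by
          rw [← map_nsmul_eq_pow hψ, nsmul_eq_mul, CharP.cast_eq_zero, zero_mul,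
            map_zero_eq_one hψ]
        have := IsPrimitiveRoot.orderOf (ψ x)
        rw [orderOf_eq_prime hpow hx] at this
        exact ⟨ψ x, IsPrimitiveRoot.coe_units_iff.mpr this⟩
      cyc := rootsOfUnity.isCyclic R p }
  have : HasEnoughRootsOfUnity R (Monoid.exponent (Multiplicative W)) :=
    HasEnoughRootsOfUnity.of_dvd R hexp
  let dual (w : W) : Multiplicative W →* Rˣ :=
    { toFun := fun v ↦ ψ (β w v.toAdd)
      map_one' := by simp [map_zero_eq_one hψ]
      map_mul' := fun u v ↦ by simp [hψ] }
  have hinj : Function.Injective dual := by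
    intro w w' h
    rw [← sub_eq_zero]
    refine hnd _ fun u ↦ ?_
    by_contra hu
    obtain ⟨x, hx⟩ := hψnt
    have key : ψ (β w ((x / β (w - w') u) • u)) = ψ (β w' ((x / β (w - w') u) • u)) :=
      DFunLike.congr_fun h (Multiplicative.ofAdd _)
    have split : β w ((x / β (w - w') u) • u) = x + β w' ((x / β (w - w') u) • u) := by
      rw [← sub_eq_iff_eq_add, ← LinearMap.sub_apply, ← map_sub, map_smul, smul_eq_mul,
        div_mul_cancel₀ _ hu]
    rw [split, hψ] at key
    exact hx (by simpa using key)
  have hcard : Nat.card W = Nat.card (Multiplicative W →* Rˣ) := by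
    rw [CommGroup.card_monoidHom_of_hasEnoughRootsOfUnity]
    rfl
  have hbij := (Nat.bijective_iff_injective_and_card dual).mpr ⟨hinj, hcard⟩
  obtain ⟨γ', hγ'⟩ := MonoidHom.domRestrict_surjective R (AddSubgroup.toSubgroup A) γ
  obtain ⟨w, hw⟩ := hbij.surjective γ'
  refine ⟨w, fun a ↦ ?_⟩
  rw [← hγ', ← hw]
  rfl

/-- Orthogonality: the character `a ↦ ψ ⟨v, a⟩` of `A` sums to zero unless it is trivial. -/
lemma sum_psi_pairing_eq_zero (hψ : ∀ x y, ψ (x + y) = ψ x * ψ y)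
    (A : AddSubgroup W) [Fintype A] {v : W} (hv : ¬ ∀ a ∈ A, ψ (β v a) = 1) :
    ∑ a : A, (ψ (β v a) : R) = 0 := by
  push Not at hv
  obtain ⟨b, hb, hne⟩ := hv
  have key : (ψ (β v b) : R) * ∑ a : A, (ψ (β v a) : R) = ∑ a : A, (ψ (β v a) : R) := by
    rw [Finset.mul_sum]
    refine Fintype.sum_equiv (Equiv.addLeft (⟨b, hb⟩ : A)) _ _ fun a ↦ ?_
    simp [hψ]
  have hmul : ((ψ (β v b) : R) - 1) * ∑ a : A, (ψ (β v a) : R) = 0 := by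
    rw [sub_mul, key, one_mul, sub_self]
  refine (mul_eq_zero.mp hmul).resolve_left fun h ↦ hne (Units.ext ?_)
  exact sub_eq_zero.mp h

end Characters

/-! ## Isomorphisms between induced representations -/

section Intertwiners

variable {β : W →ₗ[F] W →ₗ[F] F} {R : Type*} [CommRing R]

/-- Left translation by `s` identifies the representations induced from `χ` and from its
conjugate by `s`. -/
def IndV.leftTranslate {A : AddSubgroup W} {χ χ' : Heis β → Rˣ} (s : Heis β)
    (hs : ∀ a, a.w ∈ A → χ' a = χ (s * a * s⁻¹)) : IndV β R A χ ≃ₗ[R] IndV β R A χ' where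
  toFun f := ⟨fun h ↦ f.1 (s * h), fun a ha h ↦ by
    have := f.2 (s * a * s⁻¹) (by simpa using ha) (s * h)
    rw [hs a ha, ← this]
    simp [mul_assoc]⟩
  invFun f := ⟨fun h ↦ f.1 (s⁻¹ * h), fun a ha h ↦ by
    have ha' : (s⁻¹ * a * s).w ∈ A := by simpa using ha
    have := f.2 (s⁻¹ * a * s) ha' (s⁻¹ * h)
    rw [hs _ ha'] at this
    simpa [mul_assoc] using this⟩
  map_add' _ _ := rfl
  map_smul' _ _ := rfl
  left_inv f := by ext h; simp
  right_inv f := by ext h; simp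

lemma IndV.leftTranslate_hActV {A : AddSubgroup W} {χ χ' : Heis β → Rˣ} (s : Heis β)
    (hs : ∀ a, a.w ∈ A → χ' a = χ (s * a * s⁻¹)) (h₀ : Heis β) (f : IndV β R A χ) :
    leftTranslate s hs (hActV β R A χ h₀ f) = hActV β R A χ' h₀ (leftTranslate s hs f) := by
  ext h
  exact congrArg f.1 (mul_assoc s h h₀)

lemma gHeis_mul (g : W ≃ₗ[F] W) (hg : ∀ u v, β (g u) (g v) = β u v) (a b : Heis β) :
    gHeis β g (a * b) = gHeis β g a * gHeis β g b := by
  ext <;> simp [gHeis, hg]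

/-- A symplectic automorphism `g` carries the representation induced from `A_H` to the one
induced from `(gA)_H`. -/
def IndV.transport (A : AddSubgroup W) (ψ : F → Rˣ) (g : W ≃ₗ[F] W)
    (hg : ∀ u v, β (g u) (g v) = β u v) :
    IndV β R A (fun h ↦ ψ h.t) ≃ₗ[R]
      IndV β R (A.map (g : W →+ W)) (fun h ↦ ψ h.t) where
  toFun f := ⟨fun h ↦ f.1 (gHeis β g.symm h), fun a ha h ↦ by
    obtain ⟨b, hb, hba⟩ := ha
    have hsymm : ∀ u v, β (g.symm u) (g.symm v) = β u v := fun u v ↦ by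
      rw [← hg, g.apply_symm_apply, g.apply_symm_apply]
    dsimp only
    rw [gHeis_mul g.symm hsymm]
    refine f.2 (gHeis β g.symm a) ?_ _
    simpa [gHeis, ← hba] using hb⟩
  invFun f := ⟨fun h ↦ f.1 (gHeis β g h), fun a ha h ↦ by
    dsimp only
    rw [gHeis_mul g hg]
    exact f.2 (gHeis β g a) ⟨a.w, ha, rfl⟩ _⟩
  map_add' _ _ := rfl
  map_smul' _ _ := rfl
  left_inv f := by ext h; simp [gHeis]
  right_inv f := by ext h; simp [gHeis]

lemma IndV.transport_hActV (A : AddSubgroup W) (ψ : F → Rˣ) (g : W ≃ₗ[F] W)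
    (hg : ∀ u v, β (g u) (g v) = β u v) (h₀ : Heis β) (f : IndV β R A (fun h ↦ ψ h.t)) :
    transport A ψ g hg (hActV β R A _ h₀ f) =
      hActV β R _ _ (gHeis β g h₀) (transport A ψ g hg f) := by
  ext h
  change f.1 (gHeis β g.symm h * h₀) = f.1 (gHeis β g.symm (h * gHeis β g h₀))
  refine congrArg f.1 (Heis.ext ?_ ?_)
  · simp [gHeis]
  · simp [gHeis, ← hg (g.symm h.w)]

/-- Averaging over `A'` sends the representation induced from `A_H` to the one induced from
`A'_H`. -/
def IndV.average {ψ : F → Rˣ} (hψ : ∀ x y, ψ (x + y) = ψ x * ψ y) (A A' : AddSubgroup W)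
    [Fintype A'] (hhalf : ∀ a ∈ A', ∀ b ∈ A', ψ ((2 : F)⁻¹ * β a b) = 1) :
    IndV β R A (fun h ↦ ψ h.t) →ₗ[R] IndV β R A' (fun h ↦ ψ h.t) where
  toFun f := ⟨fun h ↦ ∑ a : A', f.1 (⟨a, 0⟩ * h), fun b hb h ↦ by
    rw [Finset.mul_sum]
    refine Fintype.sum_equiv (Equiv.addRight (⟨b.w, hb⟩ : A')) _ _ fun a ↦ ?_
    have hf := f.2 ⟨0, b.t + (2 : F)⁻¹ * β a b.w⟩ A.zero_mem (⟨a + b.w, 0⟩ * h)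
    simp only [hψ, hhalf a a.2 b.w hb, mul_one] at hf
    refine Eq.trans (congrArg f.1 ?_) hf
    rw [← mul_assoc, ← mul_assoc]
    congr 1
    ext <;> simp⟩
  map_add' f f' := by ext h; simp [Finset.sum_add_distrib]
  map_smul' c f := by ext h; simp [Finset.mul_sum]

lemma IndV.average_hActV {ψ : F → Rˣ} (hψ : ∀ x y, ψ (x + y) = ψ x * ψ y)
    (A A' : AddSubgroup W) [Fintype A']
    (hhalf : ∀ a ∈ A', ∀ b ∈ A', ψ ((2 : F)⁻¹ * β a b) = 1)
    (h₀ : Heis β) (f : IndV β R A (fun h ↦ ψ h.t)) :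
    average hψ A A' hhalf (hActV β R A _ h₀ f) = hActV β R A' _ h₀ (average hψ A A' hhalf f) := by
  ext h
  exact Finset.sum_congr rfl fun a _ ↦ congrArg f.1 (mul_assoc _ h h₀)

lemma IndV.average_average {ψ : F → Rˣ} (hψ : ∀ x y, ψ (x + y) = ψ x * ψ y)
    (h2 : (2 : F) ≠ 0) (halt : ∀ v, β v v = 0)
    (A A' : AddSubgroup W) [Fintype A] [Fintype A']
    (hA : ∀ a ∈ A, ∀ b ∈ A, ψ (β a b) = 1)
    (hsum : ∀ v ∉ A, ∑ a : A, (ψ (β v a) : R) = 0)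
    (hhalf : ∀ a ∈ A, ∀ b ∈ A, ψ ((2 : F)⁻¹ * β a b) = 1)
    (hhalf' : ∀ a ∈ A', ∀ b ∈ A', ψ ((2 : F)⁻¹ * β a b) = 1)
    (f : IndV β R A (fun h ↦ ψ h.t)) :
    average hψ A' A hhalf (average hψ A A' hhalf' f) =
      ((Nat.card (A ⊓ A' : AddSubgroup W) : R) * Nat.card A) • f := by
  classical
  have hψ0 := map_zero_eq_one hψ
  have hcomm (a : A) (a' : A') (h : Heis β) :
      f.1 (⟨a', 0⟩ * (⟨a, 0⟩ * h)) = ψ (β a' a) * f.1 (⟨a', 0⟩ * h) := by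
    have hf := f.2 ⟨a, β a' a⟩ a.2 (⟨a', 0⟩ * h)
    refine Eq.trans (congrArg f.1 ?_) hf
    rw [← mul_assoc, ← mul_assoc]
    congr 1
    have hskew : β (a : W) a' = - β (a' : W) a := by
      have := halt ((a : W) + a')
      simp only [map_add, LinearMap.add_apply, halt] at this
      linear_combination this
    ext
    · simp [add_comm]
    · simp only [Heis.mul_t, hskew]
      field_simp
      ring
  have hinner (a' : A') (h : Heis β) :
      ∑ a : A, f.1 (⟨a', 0⟩ * (⟨a, 0⟩ * h)) =
        if (a' : W) ∈ A then (Nat.card A : R) * f.1 h else 0 := by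
    simp only [hcomm, ← Finset.sum_mul]
    split_ifs with ha'
    · have hf := f.2 ⟨a', 0⟩ ha' h
      simp only [hψ0, Units.val_one, one_mul] at hf
      rw [hf]
      simp [hA _ ha' _ (Subtype.prop _)]
    · rw [hsum _ ha', zero_mul]
  have hcard : ((Finset.univ.filter fun a' : A' ↦ (a' : W) ∈ A).card : R) =
      Nat.card (A ⊓ A' : AddSubgroup W) := by
    rw [← Fintype.card_subtype, ← Nat.card_eq_fintype_card]
    congr 1
    exact Nat.card_congr
      { toFun := fun x ↦ ⟨x.1, x.2, x.1.2⟩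
        invFun := fun x ↦ ⟨⟨x.1, x.2.2⟩, x.2.1⟩
        left_inv := fun _ ↦ rfl
        right_inv := fun _ ↦ rfl }
  ext h
  change ∑ a : A, ∑ a' : A', f.1 (⟨a', 0⟩ * (⟨a, 0⟩ * h)) = _ * f.1 h
  rw [Finset.sum_comm]
  simp only [hinner]
  rw [← Finset.sum_filter, Finset.sum_const, nsmul_eq_mul, hcard, mul_assoc]

/-- The representations induced from two self-dual subgroups are isomorphic. -/
lemma IndV.exists_equiv_of_selfDual {ψ : F → Rˣ} (hψ : ∀ x y, ψ (x + y) = ψ x * ψ y)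
    (h2 : (2 : F) ≠ 0) (halt : ∀ v, β v v = 0)
    (A A' : AddSubgroup W) [Fintype A] [Fintype A']
    (hunit : ∀ B : AddSubgroup W, IsUnit (Nat.card B : R))
    (hA : ∀ a ∈ A, ∀ b ∈ A, ψ (β a b) = 1)
    (hA' : ∀ a ∈ A', ∀ b ∈ A', ψ (β a b) = 1)
    (hsum : ∀ v ∉ A, ∑ a : A, (ψ (β v a) : R) = 0)
    (hsum' : ∀ v ∉ A', ∑ a : A', (ψ (β v a) : R) = 0)
    (hhalf : ∀ a ∈ A, ∀ b ∈ A, ψ ((2 : F)⁻¹ * β a b) = 1)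
    (hhalf' : ∀ a ∈ A', ∀ b ∈ A', ψ ((2 : F)⁻¹ * β a b) = 1) :
    ∃ e : IndV β R A (fun h ↦ ψ h.t) ≃ₗ[R] IndV β R A' (fun h ↦ ψ h.t),
      ∀ h₀ f, e (hActV β R A _ h₀ f) = hActV β R A' _ h₀ (e f) := by
  refine ⟨LinearEquiv.ofBijective (average hψ A A' hhalf') ⟨?_, ?_⟩, average_hActV hψ A A' hhalf'⟩
  · intro f f' hff'
    have := congrArg (average hψ A' A hhalf) hff'
    rw [average_average hψ h2 halt A A' hA hsum, average_average hψ h2 halt A A' hA hsum] at this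
    exact (((hunit _).mul (hunit _)).smul_left_cancel).mp this
  · intro f
    obtain ⟨c, hc⟩ := (hunit (A' ⊓ A)).mul (hunit A')
    refine ⟨(↑c⁻¹ : R) • average hψ A' A hhalf f, ?_⟩
    rw [map_smul, average_average hψ h2 halt A' A hA' hsum', ← hc, smul_smul, Units.inv_mul,
      one_smul]

end Intertwiners

/-- For every `g ∈ Sp(W)` there is a `ℬ`-linear automorphism `M` of
`V_A^ℬ` with `M ∘ ρ(h) = ρ(g·h) ∘ M` for all `h ∈ H`. -/
theorem statement_5
    (p : ℕ+) [Fact (Nat.Prime (p : ℕ))] (hp2 : (p : ℕ) ≠ 2)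
    {F : Type*} [Field F] [Fintype F] [CharP F (p : ℕ)]
    {W : Type*} [AddCommGroup W] [Module F W] [FiniteDimensional F W]
    (β : W →ₗ[F] W →ₗ[F] F)
    (halt : ∀ v : W, β v v = 0)
    (hnd : ∀ v : W, (∀ u : W, β v u = 0) → v = 0)
    (ℬ : Type*) [CommRing ℬ] [Algebra (AA p) ℬ]
    (ψ : F → (AA p)ˣ) (hψ : ∀ x y : F, ψ (x + y) = ψ x * ψ y)
    (hψnt : ∃ x : F, ψ x ≠ 1)
    (A : AddSubgroup W)
    (hA : ∀ v : W, (∀ a ∈ A, ψ (β v a) = 1) ↔ v ∈ A)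
    (ψA : Heis β → (AA p)ˣ)
    (hψA : ∀ a b : Heis β, a.w ∈ A → b.w ∈ A → ψA (a * b) = ψA a * ψA b)
    (hψAext : ∀ t : F, ψA ⟨0, t⟩ = ψ t)
    (g : W ≃ₗ[F] W) (hg : ∀ u v : W, β (g u) (g v) = β u v) :
    ∃ M : ↥(IndV β ℬ A (chB p ℬ ψA)) ≃ₗ[ℬ] ↥(IndV β ℬ A (chB p ℬ ψA)),
      ∀ (h₀ : Heis β) (f : ↥(IndV β ℬ A (chB p ℬ ψA))),
        M (hActV β ℬ A (chB p ℬ ψA) h₀ f) =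
          hActV β ℬ A (chB p ℬ ψA) (gHeis β g h₀) (M f) := by
  have hp : (p : ℕ).Prime := Fact.out
  have : Finite W := Module.finite_of_finite F
  have h2 : (2 : F) ≠ 0 := Ring.two_ne_zero (by rwa [ringChar.eq F (p : ℕ)])
  have hψ0 := map_zero_eq_one hψ
  have hhalf : ∀ B : AddSubgroup W, (∀ a ∈ B, ∀ b ∈ B, ψ (β a b) = 1) →
      ∀ a ∈ B, ∀ b ∈ B, ψ ((2 : F)⁻¹ * β a b) = 1 := by
    intro B hB a ha b hb
    obtain ⟨k, hk⟩ := hp.odd_of_ne_two hp2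
    have hinv : (2 : F)⁻¹ = ((k + 1 : ℕ) : F) := by
      rw [inv_eq_iff_eq_inv, eq_comm, inv_eq_of_mul_eq_one_left]
      have := CharP.cast_eq_zero F (p : ℕ)
      rw [hk] at this
      push_cast at this ⊢
      linear_combination this
    rw [hinv, ← nsmul_eq_mul, map_nsmul_eq_pow hψ, hB a ha b hb, one_pow]
  have hAA : ∀ a ∈ A, ∀ b ∈ A, ψ (β a b) = 1 := fun a ha ↦ (hA a).mpr ha
  let γ : Multiplicative A →* (AA p)ˣ :=
    { toFun := fun a ↦ (ψA ⟨a.toAdd, 0⟩)⁻¹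
      map_one' := by simp [hψAext, hψ0]
      map_mul' := fun a b ↦ by
        rw [← mul_inv, ← hψA _ _ a.toAdd.2 b.toAdd.2]
        have hsplit : (⟨a.toAdd, 0⟩ * ⟨b.toAdd, 0⟩ : Heis β) =
            ⟨0, (2 : F)⁻¹ * β a.toAdd b.toAdd⟩ * ⟨(a * b).toAdd, 0⟩ := by
          ext <;> simp
        rw [hsplit, hψA _ _ A.zero_mem (a * b).toAdd.2, hψAext,
          hhalf A hAA _ a.toAdd.2 _ b.toAdd.2, one_mul] }
  obtain ⟨w, hw⟩ := exists_eq_psi_pairing (p : ℕ) hnd hψ hψnt A γ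
  let ψB := psB p ℬ ψ
  have hψB : ∀ x y, ψB (x + y) = ψB x * ψB y := fun x y ↦ by simp [ψB, psB, hψ]
  have hone : ∀ x, ψ x = 1 → ψB x = 1 := fun x hx ↦ by simp [ψB, psB, hx]
  have hconj : ∀ a : Heis β, a.w ∈ A →
      ψB a.t = chB p ℬ ψA ((⟨w, 0⟩ : Heis β) * a * (⟨w, 0⟩ : Heis β)⁻¹) := by
    intro a ha
    have hskew : β a.w w = - β w a.w := by
      have := halt (a.w + w)
      simp only [map_add, LinearMap.add_apply, halt] at this
      linear_combination this
    have hsplit : (⟨w, 0⟩ : Heis β) * a * (⟨w, 0⟩ : Heis β)⁻¹ =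
        ⟨0, a.t + β w a.w⟩ * ⟨a.w, 0⟩ := by
      ext
      · simp
      · simp only [Heis.mul_t, Heis.mul_w, Heis.inv_w, Heis.inv_t, map_neg, map_add, map_zero,
          LinearMap.add_apply, LinearMap.zero_apply, halt, hskew]
        field_simp
        ring
    have hγ : ψ (β w a.w) = (ψA ⟨a.w, 0⟩)⁻¹ := (hw ⟨a.w, ha⟩).symm
    rw [hsplit]
    simp only [chB, ψB, psB]
    rw [hψA ⟨0, _⟩ ⟨a.w, 0⟩ A.zero_mem ha, hψAext, hψ, hγ, inv_mul_cancel_right]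
  let A' := A.map (g : W →+ W)
  have hA' : ∀ v : W, (∀ a ∈ A', ψ (β v a) = 1) ↔ v ∈ A' := by
    intro v
    obtain ⟨u, rfl⟩ := g.surjective v
    have hmem : g u ∈ A' ↔ u ∈ A :=
      ⟨fun ⟨b, hb, hbu⟩ ↦ g.injective hbu ▸ hb, fun hu ↦ ⟨u, hu, rfl⟩⟩
    rw [hmem, ← hA u]
    constructor
    · intro h a ha
      rw [← hg]
      exact h _ ⟨a, ha, rfl⟩
    · rintro h _ ⟨a, ha, rfl⟩
      exact (congrArg ψ (hg u a)).trans (h a ha)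
  have hAA' : ∀ a ∈ A', ∀ b ∈ A', ψ (β a b) = 1 := fun a ha ↦ (hA' a).mpr ha
  have := Fintype.ofFinite A
  have := Fintype.ofFinite A'
  have hsum : ∀ (B : AddSubgroup W) [Fintype B],
      (∀ v : W, (∀ a ∈ B, ψ (β v a) = 1) ↔ v ∈ B) →
      ∀ v ∉ B, ∑ a : B, (ψB (β v a) : ℬ) = 0 := by
    intro B _ hB v hv
    have h := congrArg (algebraMap (AA p) ℬ)
      (sum_psi_pairing_eq_zero hψ B (mt (hB v).mp hv))
    rwa [map_sum, map_zero] at h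
  have hpB : IsUnit ((p : ℕ) : ℬ) := by
    simpa using (AA.isUnit_natCast p).map (algebraMap (AA p) ℬ)
  obtain ⟨e, he⟩ := IndV.exists_equiv_of_selfDual hψB h2 halt A' A
    (isUnit_natCard_addSubgroup (F := F) (p : ℕ) hpB)
    (fun a ha b hb ↦ hone _ (hAA' a ha b hb)) (fun a ha b hb ↦ hone _ (hAA a ha b hb))
    (hsum A' hA') (hsum A hA)
    (fun a ha b hb ↦ hone _ (hhalf A' hAA' a ha b hb))
    (fun a ha b hb ↦ hone _ (hhalf A hAA a ha b hb))
  let T := IndV.leftTranslate (χ := chB p ℬ ψA) (χ' := fun h ↦ ψB h.t) ⟨w, 0⟩ hconj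
  have hT : ∀ h₀ f, T (hActV β ℬ A _ h₀ f) = hActV β ℬ A _ h₀ (T f) :=
    IndV.leftTranslate_hActV _ hconj
  refine ⟨T.trans ((IndV.transport A ψB g hg).trans (e.trans T.symm)), fun h₀ f ↦ ?_⟩
  simp only [LinearEquiv.trans_apply]
  rw [hT, IndV.transport_hActV, he, LinearEquiv.symm_apply_eq, hT, LinearEquiv.apply_symm_apply]
end
end
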